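/- arXiv:2010.04188 — 2 statements merged into one kernel-verified Lean document; each statement's English description precedes it below -/
import Mathlib

section
/- For all real numbers p and q with 2 ≤ q ≤ p, one has p + q ≤ 2·√2·(p/q)·√(p·(q − 1)). -/
theorem torus_ribbonlength_sublinear (p q : ℝ) (hq : 2 ≤ q) (hqp : q ≤ p) :
    p + q ≤ 2 * Real.sqrt 2 * (p / q) * Real.sqrt (p * (q - 1)) := by
  have hq0 : 0 < q := by linarith
  have hp0 : 0 < p := by linarith
  have key : q ≤ Real.sqrt 2 * Real.sqrt (p * (q - 1)) := by
    rw [← Real.sqrt_mul zero_le_two]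
    apply Real.le_sqrt_of_sq_le
    nlinarith [mul_nonneg (sub_nonneg.2 hqp) (by linarith : 0 ≤ q - 1),
      mul_nonneg hq0.le (sub_nonneg.2 hq)]
  calc p + q ≤ 2 * (p / q) * q := by
        rw [mul_assoc, div_mul_cancel₀ p hq0.ne']
        linarith
    _ ≤ 2 * (p / q) * (Real.sqrt 2 * Real.sqrt (p * (q - 1))) := by gcongr
    _ = 2 * Real.sqrt 2 * (p / q) * Real.sqrt (p * (q - 1)) := by ring
end

section
/- Let p, q, a, b be nonnegative integers with 2 ≤ q ≤ p and p = a·q + b. Then, as real numbers, p + q ≤ 2·√2·(a + b/2)·√(p·(q − 1)). (Hence any (p,q) torus link type L with p ≥ q ≥ 2 and p = aq + b contains a folded ribbon link L_w with Rib(L_w) ≤ 2√2·(a + b/2)·Cr(L)^{1/2}, since Rib(L_w) ≤ p + q and Cr(L) = p(q − 1).) -/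
theorem torus_ribbonlength_crossing (p q a b : ℕ) (hq : 2 ≤ q) (hqp : q ≤ p)
    (hp : p = a * q + b) :
    (p : ℝ) + q ≤ 2 * Real.sqrt 2 * ((a : ℝ) + b / 2) * Real.sqrt ((p : ℝ) * ((q : ℝ) - 1)) := by
  have hq' : (2 : ℝ) ≤ q := by exact_mod_cast hq
  have hqp' : (q : ℝ) ≤ p := by exact_mod_cast hqp
  have hp' : (p : ℝ) = a * q + b := by exact_mod_cast hp
  have hb : (0 : ℝ) ≤ b := b.cast_nonneg
  have hsqrt : (q : ℝ) ≤ √2 * √((p : ℝ) * ((q : ℝ) - 1)) := by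
    rw [← Real.sqrt_mul zero_le_two]
    apply Real.le_sqrt_of_sq_le
    nlinarith [mul_nonneg (sub_nonneg.2 hqp') (sub_nonneg.2 hq')]
  calc (p : ℝ) + q ≤ 2 * p := by linarith
    _ ≤ 2 * ((a : ℝ) + b / 2) * q := by nlinarith
    _ ≤ 2 * ((a : ℝ) + b / 2) * (√2 * √((p : ℝ) * ((q : ℝ) - 1))) := by gcongr
    _ = 2 * √2 * ((a : ℝ) + b / 2) * √((p : ℝ) * ((q : ℝ) - 1)) := by ring
end
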